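/- arXiv:1708.00548 — 3 statements merged into one kernel-verified Lean document; each statement's English description precedes it below -/
import Mathlib

section
/- Under the hypotheses of the nonhomogeneous-equation theorem (paths 𝓛(ξ) from α₁ through ξ to α₂ with Re(ut) monotonic and Re(ut) → ∓∞ at α₁, α₂; coefficients G₀ = −ϖ, G_{s+1} = G_s″ − ψG_s; ∫_{𝓛(ξ)} |ψ(t)| |dt| < 2|u|; existence of all integrals and suprema), the error ε_n(u,ξ) of the unique bounded particular solution G(u,ξ) = u⁻² Σ_{s=0}^{n−1} G_s(ξ)/u^{2s} + ε_n(u,ξ) satisfies, for every positive integer r, |ε_n(u,ξ)| ≤ |Σ_{s=n}^{n+r−1} G_s(ξ)/u^{2s+2}| + |u|^{−(2n+2r+2)} { |G_{n+r}(ξ)| + ½ ∫_{𝓛(ξ)} |G_{n+r}′(t)| |dt| } + (L_{n+r}(ξ)/(2|u|^{2n+2r+3})) · {1 − (1/(2|u|)) ∫_{𝓛(ξ)} |ψ(t)| |dt|}⁻¹ · ∫_{𝓛(ξ)} |ψ(t)| |dt|, where L_m(ξ) = sup_{w∈𝓛(ξ)} |G_m(w)| + ½ ∫_{𝓛(ξ)}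 |G_m′(t)| |dt|. -/
open MeasureTheory

open Set Filter Topology in
theorem norm_mul_exp_sub_le_of_hasDerivAt {φ φ' P g : ℝ → ℂ} {k : ℝ → ℝ} {s t M : ℝ} (hst : s ≤ t)
    (hφ : ∀ x ∈ Icc s t, HasDerivAt φ (φ' x) x)
    (hP : ∀ x ∈ Icc s t, HasDerivAt P (φ' x * P x + g x) x)
    (hg : ∀ x ∈ Icc s t, ‖g x‖ ≤ k x) (hk : IntegrableOn k (Ioc s t))
    (hM : ∀ x ∈ Icc s t, -(φ x).re ≤ M) :
    ‖P t * Complex.exp (-φ t) - P s * Complex.exp (-φ s)‖ ≤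
      Real.exp M * ∫ x in Ioc s t, k x := by
  have hd : ∀ x ∈ Icc s t, HasDerivAt (fun x => P x * Complex.exp (-φ x))
      (g x * Complex.exp (-φ x)) x := by
    intro x hx
    exact ((hP x hx).mul (hφ x hx).fun_neg.cexp).congr_deriv (by ring)
  have hle : ∀ x ∈ Icc s t, ‖g x * Complex.exp (-φ x)‖ ≤ Real.exp M * k x := by
    intro x hx
    rw [norm_mul, Complex.norm_exp, Complex.neg_re, mul_comm]
    exact mul_le_mul (Real.exp_le_exp.2 (hM x hx)) (hg x hx) (norm_nonneg _) (Real.exp_pos _).le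
  have hi : IntegrableOn (deriv fun x => P x * Complex.exp (-φ x)) (Ioc s t) := by
    refine Integrable.mono' (hk.const_mul (Real.exp M)) (measurable_deriv _).aestronglyMeasurable ?_
    refine (ae_restrict_iff' measurableSet_Ioc).2 (Eventually.of_forall fun x hx => ?_)
    rw [(hd x (Ioc_subset_Icc_self hx)).deriv]
    exact hle x (Ioc_subset_Icc_self hx)
  rw [← intervalIntegral.integral_eq_sub_of_hasDerivAt
    (f := fun x => P x * Complex.exp (-φ x)) (a := s) (b := t)
    (fun x hx => (hd x (by rwa [uIcc_of_le hst] at hx)).differentiableAt.hasDerivAt)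
    ((intervalIntegrable_iff_integrableOn_Ioc_of_le hst).2 hi),
    intervalIntegral.integral_of_le hst, ← integral_const_mul]
  refine norm_integral_le_of_norm_le (hk.const_mul (Real.exp M)) ?_
  refine (ae_restrict_iff' measurableSet_Ioc).2 (Eventually.of_forall fun x hx => ?_)
  rw [(hd x (Ioc_subset_Icc_self hx)).deriv]
  exact hle x (Ioc_subset_Icc_self hx)

open Set Filter Topology in
theorem norm_left_le_of_hasDerivAt {φ φ' P g : ℝ → ℂ} {k : ℝ → ℝ} {s t : ℝ} (hst : s ≤ t)
    (hφ : ∀ x ∈ Icc s t, HasDerivAt φ (φ' x) x)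
    (hP : ∀ x ∈ Icc s t, HasDerivAt P (φ' x * P x + g x) x)
    (hg : ∀ x ∈ Icc s t, ‖g x‖ ≤ k x) (hk : IntegrableOn k (Ioc s t))
    (hmono : MonotoneOn (fun x => (φ x).re) (Icc s t)) :
    ‖P s‖ ≤ ‖P t‖ * Real.exp ((φ s).re - (φ t).re) + ∫ x in Ioc s t, k x := by
  have h := norm_mul_exp_sub_le_of_hasDerivAt hst hφ hP hg hk (M := -(φ s).re)
    fun x hx => neg_le_neg (hmono (left_mem_Icc.2 hst) hx hx.1)
  have h1 := (norm_sub_norm_le (P s * Complex.exp (-φ s)) (P t * Complex.exp (-φ t))).trans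
    ((norm_sub_rev _ _).le.trans h)
  simp only [norm_mul, Complex.norm_exp, Complex.neg_re] at h1
  have he : Real.exp (φ s).re * Real.exp (-(φ s).re) = 1 := by rw [← Real.exp_add]; simp
  have h2 := mul_le_mul_of_nonneg_left h1 (Real.exp_pos (φ s).re).le
  rw [sub_eq_add_neg (φ s).re, Real.exp_add]
  linear_combination h2 + (‖P s‖ - ∫ x in Ioc s t, k x) * (- he)

open Set Filter Topology in
theorem norm_right_le_of_hasDerivAt {φ φ' Q g : ℝ → ℂ} {k : ℝ → ℝ} {s t : ℝ} (hst : s ≤ t)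
    (hφ : ∀ x ∈ Icc s t, HasDerivAt φ (φ' x) x)
    (hQ : ∀ x ∈ Icc s t, HasDerivAt Q (-φ' x * Q x + g x) x)
    (hg : ∀ x ∈ Icc s t, ‖g x‖ ≤ k x) (hk : IntegrableOn k (Ioc s t))
    (hmono : MonotoneOn (fun x => (φ x).re) (Icc s t)) :
    ‖Q t‖ ≤ ‖Q s‖ * Real.exp ((φ s).re - (φ t).re) + ∫ x in Ioc s t, k x := by
  have h := norm_mul_exp_sub_le_of_hasDerivAt (φ := fun x => -φ x) (φ' := fun x => -φ' x) hst
    (fun x hx => (hφ x hx).neg) hQ hg hk (M := (φ t).re)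
    fun x hx => by simpa using hmono hx (right_mem_Icc.2 hst) hx.2
  have h1 := (norm_sub_norm_le _ _).trans h
  simp only [norm_mul, Complex.norm_exp, neg_neg] at h1
  have he : Real.exp (-(φ t).re) * Real.exp (φ t).re = 1 := by rw [← Real.exp_add]; simp
  have h2 := mul_le_mul_of_nonneg_left h1 (Real.exp_pos (-(φ t).re)).le
  rw [sub_eq_add_neg (φ s).re, Real.exp_add]
  linear_combination h2 + (‖Q t‖ - ∫ x in Ioc s t, k x) * (- he)

open Set Filter Topology in
/-- If `P' = φ' P + g` and `Q' = -φ' Q + h` along an interval on which `Re φ` increases from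
`-∞` to `∞`, and `P - Q` is bounded, then `‖P‖ + ‖Q‖` is controlled by the total forcing. -/
theorem norm_add_norm_le_integral_of_dichotomy {φ φ' P Q g h : ℝ → ℂ} {k : ℝ → ℝ} {a b R : ℝ}
    (hφ : ∀ x ∈ Ioo a b, HasDerivAt φ (φ' x) x)
    (hP : ∀ x ∈ Ioo a b, HasDerivAt P (φ' x * P x + g x) x)
    (hQ : ∀ x ∈ Ioo a b, HasDerivAt Q (-φ' x * Q x + h x) x)
    (hg : ∀ x ∈ Ioo a b, ‖g x‖ ≤ k x) (hh : ∀ x ∈ Ioo a b, ‖h x‖ ≤ k x)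
    (hk : IntegrableOn k (Ioo a b))
    (hmono : MonotoneOn (fun x => (φ x).re) (Ioo a b))
    (hbot : Tendsto (fun x => (φ x).re) (𝓝[>] a) atBot)
    (htop : Tendsto (fun x => (φ x).re) (𝓝[<] b) atTop)
    (hR : ∀ x ∈ Ioo a b, ‖P x - Q x‖ ≤ R) {t : ℝ} (ht : t ∈ Ioo a b) :
    ‖P t‖ + ‖Q t‖ ≤ ∫ x in Ioo a b, k x := by
  have hk0 : 0 ≤ᵐ[volume.restrict (Ioo a b)] k :=
    (ae_restrict_iff' measurableSet_Ioo).2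
      (Eventually.of_forall fun x hx => (norm_nonneg _).trans (hg x hx))
  have hleft : ∀ s x, a < s → s ≤ x → x < b →
      ‖P s‖ ≤ ‖P x‖ * Real.exp ((φ s).re - (φ x).re) + ∫ y in Ioc s x, k y := by
    intro s x h1 h2 h3
    have hsub : Icc s x ⊆ Ioo a b := Icc_subset_Ioo h1 h3
    exact norm_left_le_of_hasDerivAt h2 (fun y hy => hφ y (hsub hy)) (fun y hy => hP y (hsub hy))
      (fun y hy => hg y (hsub hy)) (hk.mono_set (Ioc_subset_Icc_self.trans hsub))
      (hmono.mono hsub)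
  have hright : ∀ s x, a < s → s ≤ x → x < b →
      ‖Q x‖ ≤ ‖Q s‖ * Real.exp ((φ s).re - (φ x).re) + ∫ y in Ioc s x, k y := by
    intro s x h1 h2 h3
    have hsub : Icc s x ⊆ Ioo a b := Icc_subset_Ioo h1 h3
    exact norm_right_le_of_hasDerivAt h2 (fun y hy => hφ y (hsub hy)) (fun y hy => hQ y (hsub hy))
      (fun y hy => hh y (hsub hy)) (hk.mono_set (Ioc_subset_Icc_self.trans hsub))
      (hmono.mono hsub)
  have hint : ∀ S, S ⊆ Ioo a b → ∫ y in S, k y ≤ ∫ y in Ioo a b, k y := fun S hS =>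
    setIntegral_mono_set hk hk0 hS.eventuallyLE
  have hexp : ∀ s x, a < s → s ≤ x → x < b → Real.exp ((φ s).re - (φ x).re) ≤ 1 := by
    intro s x h1 h2 h3
    rw [Real.exp_le_one_iff, sub_nonpos]
    exact hmono ⟨h1, h2.trans_lt h3⟩ ⟨h1.trans_le h2, h3⟩ h2
  obtain ⟨hat, htb⟩ := ht
  set K := ∫ y in Ioo a b, k y
  have hPb : ∀ x, t ≤ x → x < b → ‖P x‖ ≤ R + (‖Q t‖ + K) := by
    intro x h1 h2
    have h3 := hright t x hat h1 h2
    have h4 := hint (Ioc t x) fun y hy => ⟨hat.trans hy.1, hy.2.trans_lt h2⟩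
    have h5 := mul_le_of_le_one_right (norm_nonneg (Q t)) (hexp t x hat h1 h2)
    have h6 := hR x ⟨hat.trans_le h1, h2⟩
    have h7 := norm_le_norm_sub_add (P x) (Q x)
    linarith
  have hQb : ∀ x, a < x → x ≤ t → ‖Q x‖ ≤ R + (‖P t‖ + K) := by
    intro x h1 h2
    have h3 := hleft x t h1 h2 htb
    have h4 := hint (Ioc x t) fun y hy => ⟨h1.trans hy.1, hy.2.trans_lt htb⟩
    have h5 := mul_le_of_le_one_right (norm_nonneg (P t)) (hexp x t h1 h2 htb)
    have h6 := hR x ⟨h1, h2.trans_lt htb⟩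
    have h7 := norm_le_norm_sub_add (Q x) (P x)
    rw [norm_sub_rev] at h7
    linarith
  have hP' : ‖P t‖ ≤ ∫ y in Ioo t b, k y := by
    have hlim : Tendsto (fun x => (R + (‖Q t‖ + K)) * Real.exp ((φ t).re - (φ x).re)
        + ∫ y in Ioo t b, k y) (𝓝[<] b)
        (𝓝 ((R + (‖Q t‖ + K)) * 0 + ∫ y in Ioo t b, k y)) := by
      refine ((Real.tendsto_exp_atBot.comp ?_).const_mul _).add_const _
      exact tendsto_atBot_add_const_left _ _ (tendsto_neg_atTop_atBot.comp htop)
    rw [mul_zero, zero_add] at hlim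
    refine ge_of_tendsto hlim ?_
    filter_upwards [Ioo_mem_nhdsLT htb] with x hx
    refine (hleft t x hat hx.1.le hx.2).trans (add_le_add ?_ ?_)
    · exact mul_le_mul_of_nonneg_right (hPb x hx.1.le hx.2) (Real.exp_pos _).le
    · have hs : Ioo t b ⊆ Ioo a b := Ioo_subset_Ioo_left hat.le
      exact setIntegral_mono_set (hk.mono_set hs) (ae_restrict_of_ae_restrict_of_subset hs hk0)
        (LE.le.eventuallyLE fun y hy => ⟨hy.1, hy.2.trans_lt hx.2⟩)
  have hQ' : ‖Q t‖ ≤ ∫ y in Ioc a t, k y := by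
    have hlim : Tendsto (fun x => (R + (‖P t‖ + K)) * Real.exp ((φ x).re - (φ t).re)
        + ∫ y in Ioc a t, k y) (𝓝[>] a)
        (𝓝 ((R + (‖P t‖ + K)) * 0 + ∫ y in Ioc a t, k y)) := by
      refine ((Real.tendsto_exp_atBot.comp ?_).const_mul _).add_const _
      exact tendsto_atBot_add_const_right _ _ hbot
    rw [mul_zero, zero_add] at hlim
    refine ge_of_tendsto hlim ?_
    filter_upwards [Ioo_mem_nhdsGT hat] with x hx
    refine (hright x t hx.1 hx.2.le htb).trans (add_le_add ?_ ?_)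
    · exact mul_le_mul_of_nonneg_right (hQb x hx.1 hx.2.le) (Real.exp_pos _).le
    · have hs : Ioc a t ⊆ Ioo a b := fun y hy => ⟨hy.1, hy.2.trans_lt htb⟩
      exact setIntegral_mono_set (hk.mono_set hs) (ae_restrict_of_ae_restrict_of_subset hs hk0)
        (LE.le.eventuallyLE fun y hy => ⟨hx.1.trans hy.1, hy.2⟩)
  have hsum : ∫ y in Ioo a b, k y = (∫ y in Ioc a t, k y) + ∫ y in Ioo t b, k y := by
    rw [← Ioc_union_Ioo_eq_Ioo hat.le htb]
    exact setIntegral_union (disjoint_left.2 fun y h1 h2 => h1.2.not_gt h2.1) measurableSet_Ioo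
      (hk.mono_set fun y hy => ⟨hy.1, hy.2.trans_lt htb⟩)
      (hk.mono_set (Ioo_subset_Ioo_left hat.le))
  change _ ≤ ∫ y in Ioo a b, k y
  linarith

open Set Filter Topology in
/-- A priori bound for a solution of `E'' - (u² + ψ) E = -g / u ^ (2 * m)` along a path, in terms
of any bound `S` for `E` on that path. -/
theorem norm_le_of_ode_along_path {Δ : Set ℂ} (hΔ : IsOpen Δ) {ψ E g : ℂ → ℂ} {u : ℂ} (hu : u ≠ 0)
    (m : ℕ) (hE : DifferentiableOn ℂ E Δ) (hg : DifferentiableOn ℂ g Δ)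
    (hode : ∀ ζ ∈ Δ, deriv (deriv E) ζ = (u ^ 2 + ψ ζ) * E ζ - g ζ / u ^ (2 * m))
    {γ : ℝ → ℂ} (hγ : ∀ t ∈ Ioo (0 : ℝ) 1, γ t ∈ Δ)
    (hγd : ∀ t ∈ Ioo (0 : ℝ) 1, DifferentiableAt ℝ γ t)
    (hmono : MonotoneOn (fun t => (u * γ t).re) (Ioo 0 1))
    (hbot : Tendsto (fun t => (u * γ t).re) (𝓝[>] 0) atBot)
    (htop : Tendsto (fun t => (u * γ t).re) (𝓝[<] 1) atTop)
    (hψi : IntegrableOn (fun t => ‖ψ (γ t)‖ * ‖deriv γ t‖) (Ioo 0 1))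
    (hgi : IntegrableOn (fun t => ‖deriv g (γ t)‖ * ‖deriv γ t‖) (Ioo 0 1))
    {S T : ℝ} (hS : ∀ t ∈ Ioo (0 : ℝ) 1, ‖E (γ t)‖ ≤ S) (hT : ∀ t ∈ Ioo (0 : ℝ) 1, ‖g (γ t)‖ ≤ T)
    {t : ℝ} (ht : t ∈ Ioo (0 : ℝ) 1) :
    ‖E (γ t)‖ ≤ (1 / ‖u‖ ^ (2 * m + 2)) * (‖g (γ t)‖
        + (1 / 2) * ∫ t in Ioo (0 : ℝ) 1, ‖deriv g (γ t)‖ * ‖deriv γ t‖)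
      + (1 / (2 * ‖u‖)) * (S * ∫ t in Ioo (0 : ℝ) 1, ‖ψ (γ t)‖ * ‖deriv γ t‖) := by
  have hu' : 0 < ‖u‖ := norm_pos_iff.2 hu
  set c : ℂ := 1 / u ^ (2 * m + 1) with hc
  have huc : u * c = 1 / u ^ (2 * m) := by rw [hc, pow_succ]; field_simp
  have hEγ : ∀ x ∈ Ioo (0 : ℝ) 1, HasDerivAt (fun x => E (γ x)) (deriv γ x * deriv E (γ x)) x :=
    fun x hx => ((hE.differentiableAt (hΔ.mem_nhds (hγ x hx))).hasDerivAt).scomp x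
      (hγd x hx).hasDerivAt
  have hE'γ : ∀ x ∈ Ioo (0 : ℝ) 1,
      HasDerivAt (fun x => deriv E (γ x)) (deriv γ x * deriv (deriv E) (γ x)) x :=
    fun x hx => (((hE.deriv hΔ).differentiableAt (hΔ.mem_nhds (hγ x hx))).hasDerivAt).scomp x
      (hγd x hx).hasDerivAt
  have hgγ : ∀ x ∈ Ioo (0 : ℝ) 1, HasDerivAt (fun x => g (γ x)) (deriv γ x * deriv g (γ x)) x :=
    fun x hx => ((hg.differentiableAt (hΔ.mem_nhds (hγ x hx))).hasDerivAt).scomp x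
      (hγd x hx).hasDerivAt
  have hforce : ∀ x ∈ Ioo (0 : ℝ) 1, ∀ σ : ℂ, ‖σ‖ = 1 →
      ‖deriv γ x * (ψ (γ x) * E (γ x) + σ * c * deriv g (γ x))‖ ≤
        S * (‖ψ (γ x)‖ * ‖deriv γ x‖) + ‖c‖ * (‖deriv g (γ x)‖ * ‖deriv γ x‖) := by
    intro x hx σ hσ
    rw [norm_mul]
    have h1 := norm_add_le (ψ (γ x) * E (γ x)) (σ * c * deriv g (γ x))
    rw [norm_mul, norm_mul, norm_mul, hσ, one_mul] at h1
    have h2 := mul_le_mul_of_nonneg_left (hS x hx) (norm_nonneg (ψ (γ x)))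
    have h3 := mul_le_mul_of_nonneg_left (h1.trans (add_le_add_left h2 _))
      (norm_nonneg (deriv γ x))
    linarith
  have key := norm_add_norm_le_integral_of_dichotomy (φ := fun x => u * γ x)
    (φ' := fun x => u * deriv γ x)
    (P := fun x => deriv E (γ x) + u * E (γ x) - c * g (γ x))
    (Q := fun x => deriv E (γ x) - u * E (γ x) + c * g (γ x))
    (g := fun x => deriv γ x * (ψ (γ x) * E (γ x) + (-1) * c * deriv g (γ x)))
    (h := fun x => deriv γ x * (ψ (γ x) * E (γ x) + 1 * c * deriv g (γ x)))
    (k := fun x => S * (‖ψ (γ x)‖ * ‖deriv γ x‖) + ‖c‖ * (‖deriv g (γ x)‖ * ‖deriv γ x‖))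
    (R := 2 * ‖u‖ * S + 2 * ‖c‖ * T)
    (fun x hx => (hγd x hx).hasDerivAt.const_mul u)
    (fun x hx => by
      refine (((hE'γ x hx).add ((hEγ x hx).const_mul u)).sub
        ((hgγ x hx).const_mul c)).congr_deriv ?_
      rw [hode _ (hγ x hx)]
      linear_combination (deriv γ x * g (γ x)) * huc)
    (fun x hx => by
      refine (((hE'γ x hx).sub ((hEγ x hx).const_mul u)).add
        ((hgγ x hx).const_mul c)).congr_deriv ?_
      rw [hode _ (hγ x hx)]
      linear_combination (deriv γ x * g (γ x)) * huc)
    (fun x hx => hforce x hx (-1) (by simp)) (fun x hx => hforce x hx 1 (by simp))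
    ((hψi.const_mul S).add (hgi.const_mul ‖c‖)) hmono hbot htop
    (fun x hx => by
      have h1 : deriv E (γ x) + u * E (γ x) - c * g (γ x)
          - (deriv E (γ x) - u * E (γ x) + c * g (γ x))
          = 2 * u * E (γ x) - 2 * c * g (γ x) := by ring
      rw [h1]
      refine (norm_sub_le _ _).trans (add_le_add ?_ ?_)
      · simpa using mul_le_mul_of_nonneg_left (hS x hx) (by positivity : 0 ≤ 2 * ‖u‖)
      · simpa using mul_le_mul_of_nonneg_left (hT x hx) (by positivity : 0 ≤ 2 * ‖c‖)) ht
  rw [integral_add (hψi.const_mul S) (hgi.const_mul ‖c‖), integral_const_mul,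
    integral_const_mul] at key
  set p := deriv E (γ t) + u * E (γ t) - c * g (γ t)
  set q := deriv E (γ t) - u * E (γ t) + c * g (γ t)
  have hrep : E (γ t) = (1 / u ^ (2 * m + 2)) * g (γ t) + (1 / (2 * u)) * (p - q) := by
    simp only [p, q, hc]
    field_simp
    ring
  have hn : ‖E (γ t)‖ ≤ (1 / ‖u‖ ^ (2 * m + 2)) * ‖g (γ t)‖
      + (1 / (2 * ‖u‖)) * (‖p‖ + ‖q‖) := by
    conv_lhs => rw [hrep]
    refine (norm_add_le _ _).trans (add_le_add (by simp) ?_)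
    rw [norm_mul]
    refine mul_le_mul (by simp) (norm_sub_le _ _) (norm_nonneg _) (by positivity)
  refine hn.trans ((add_le_add_right (mul_le_mul_of_nonneg_left key (by positivity)) _).trans_eq ?_)
  have hcn : ‖c‖ = 1 / ‖u‖ ^ (2 * m + 1) := by simp [hc]
  rw [hcn]
  field_simp
  ring

theorem formal_series_coeff_differentiableOn {Δ : Set ℂ} (hΔ : IsOpen Δ) {ψ ϖ : ℂ → ℂ}
    (hψ : DifferentiableOn ℂ ψ Δ) (hϖ : DifferentiableOn ℂ ϖ Δ) {Gc : ℕ → ℂ → ℂ}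
    (hG0 : ∀ ξ ∈ Δ, Gc 0 ξ = -ϖ ξ)
    (hGrec : ∀ s, ∀ ξ ∈ Δ, Gc (s + 1) ξ = deriv (deriv (Gc s)) ξ - ψ ξ * Gc s ξ) (m : ℕ) :
    DifferentiableOn ℂ (Gc m) Δ := by
  induction m with
  | zero => exact hϖ.neg.congr hG0
  | succ s ih => exact (((ih.deriv hΔ).deriv hΔ).sub (hψ.mul ih)).congr (hGrec s)

theorem deriv_deriv_sub_partial_sum {Δ : Set ℂ} (hΔ : IsOpen Δ) {ψ ϖ : ℂ → ℂ} {u : ℂ} (hu : u ≠ 0)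
    {Gc : ℕ → ℂ → ℂ} (hGc : ∀ s, DifferentiableOn ℂ (Gc s) Δ)
    (hG0 : ∀ ξ ∈ Δ, Gc 0 ξ = -ϖ ξ)
    (hGrec : ∀ s, ∀ ξ ∈ Δ, Gc (s + 1) ξ = deriv (deriv (Gc s)) ξ - ψ ξ * Gc s ξ)
    {G : ℂ → ℂ} (hG : DifferentiableOn ℂ G Δ)
    (hGode : ∀ ζ ∈ Δ, deriv (deriv G) ζ - (u ^ 2 + ψ ζ) * G ζ = ϖ ζ) (m : ℕ) :
    DifferentiableOn ℂ (fun z => G z - ∑ s ∈ Finset.range m, Gc s z / u ^ (2 * s + 2)) Δ ∧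
    ∀ ζ ∈ Δ, deriv (deriv fun z => G z - ∑ s ∈ Finset.range m, Gc s z / u ^ (2 * s + 2)) ζ
      = (u ^ 2 + ψ ζ) * (G ζ - ∑ s ∈ Finset.range m, Gc s ζ / u ^ (2 * s + 2))
        - Gc m ζ / u ^ (2 * m) := by
  induction m with
  | zero =>
    simp only [Finset.range_zero, Finset.sum_empty, sub_zero]
    refine ⟨hG, fun ζ hζ => ?_⟩
    rw [hG0 ζ hζ]
    linear_combination hGode ζ hζ
  | succ m ih =>
    obtain ⟨hd, hode⟩ := ih
    set F := fun z => G z - ∑ s ∈ Finset.range m, Gc s z / u ^ (2 * s + 2) with hF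
    have heq : (fun z => G z - ∑ s ∈ Finset.range (m + 1), Gc s z / u ^ (2 * s + 2))
        = fun z => F z - Gc m z / u ^ (2 * m + 2) := by
      funext z
      rw [Finset.sum_range_succ, hF]
      ring
    rw [heq]
    have hat : ∀ {f : ℂ → ℂ}, DifferentiableOn ℂ f Δ → ∀ z ∈ Δ, DifferentiableAt ℂ f z :=
      fun hf z hz => hf.differentiableAt (hΔ.mem_nhds hz)
    refine ⟨hd.sub ((hGc m).div_const _), fun ζ hζ => ?_⟩
    have h1 : deriv (fun z => F z - Gc m z / u ^ (2 * m + 2)) =ᶠ[nhds ζ]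
        fun z => deriv F z - deriv (Gc m) z / u ^ (2 * m + 2) := by
      filter_upwards [hΔ.mem_nhds hζ] with z hz
      exact ((hat hd z hz).hasDerivAt.sub ((hat (hGc m) z hz).hasDerivAt.div_const _)).deriv
    rw [h1.deriv_eq, ((hat (hd.deriv hΔ) ζ hζ).hasDerivAt.fun_sub
      ((hat ((hGc m).deriv hΔ) ζ hζ).hasDerivAt.div_const _)).deriv, hode ζ hζ, hGrec m ζ hζ,
      Finset.sum_range_succ]
    field_simp
    ring

/-- Theorem 4.1 (second part): the sharpened error bound (for every positive integer `r`)
for the unique particular solution of `W'' - (u² + ψ)W = ϖ` that is bounded at both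
`α₁` and `α₂`.  For each `ξ ∈ Ξ` the path `γ ξ : (0,1) → Δ` runs from `α₁`
(as `t → 0⁺`, where `Re(ut) → -∞`) through `ξ` to `α₂` (as `t → 1⁻`, where
`Re(ut) → +∞`), with `Re(ut)` monotonic along it. -/
theorem nonhomogeneous_sharpened_error_bound
    (Δ : Set ℂ) (hΔ : IsOpen Δ)
    (ψ ϖ : ℂ → ℂ)
    (hψ : DifferentiableOn ℂ ψ Δ) (hϖ : DifferentiableOn ℂ ϖ Δ)
    (u : ℂ) (hu : u ≠ 0)
    (Gc : ℕ → ℂ → ℂ)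
    (hG0 : ∀ ξ ∈ Δ, Gc 0 ξ = -ϖ ξ)
    (hGrec : ∀ s, ∀ ξ ∈ Δ, Gc (s + 1) ξ = deriv (deriv (Gc s)) ξ - ψ ξ * Gc s ξ)
    (n : ℕ) (hn : 1 ≤ n)
    (Ξ : Set ℂ) (hΞ : Ξ ⊆ Δ) (hΞne : Ξ.Nonempty)
    (γ : ℂ → ℝ → ℂ)
    (hγmem : ∀ ξ ∈ Ξ, ∀ t ∈ Set.Ioo (0:ℝ) 1, γ ξ t ∈ Δ)
    (hγthrough : ∀ ξ ∈ Ξ, ∃ t ∈ Set.Ioo (0:ℝ) 1, γ ξ t = ξ)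
    (hγdiff : ∀ ξ ∈ Ξ, ∀ t ∈ Set.Ioo (0:ℝ) 1, DifferentiableAt ℝ (γ ξ) t)
    (hmono : ∀ ξ ∈ Ξ, MonotoneOn (fun t => (u * γ ξ t).re) (Set.Ioo 0 1))
    (hbot : ∀ ξ ∈ Ξ, Filter.Tendsto (fun t => (u * γ ξ t).re)
      (nhdsWithin 0 (Set.Ioi 0)) Filter.atBot)
    (htop : ∀ ξ ∈ Ξ, Filter.Tendsto (fun t => (u * γ ξ t).re)
      (nhdsWithin 1 (Set.Iio 1)) Filter.atTop)
    -- existence of all integrals and suprema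
    (hψint : ∀ ξ ∈ Ξ, IntegrableOn
      (fun t => ‖ψ (γ ξ t)‖ * ‖deriv (γ ξ) t‖) (Set.Ioo 0 1) volume)
    (hGint : ∀ ξ ∈ Ξ, ∀ m, IntegrableOn
      (fun t => ‖deriv (Gc m) (γ ξ t)‖ * ‖deriv (γ ξ) t‖) (Set.Ioo 0 1) volume)
    (hGsup : ∀ ξ ∈ Ξ, ∀ m, BddAbove
      (Set.range fun t : Set.Ioo (0:ℝ) 1 => ‖Gc m (γ ξ (t : ℝ))‖))
    -- `∫ |ψ| |dt| < 2|u|`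
    (hψsmall : ∀ ξ ∈ Ξ,
      (∫ t in Set.Ioo (0:ℝ) 1, ‖ψ (γ ξ t)‖ * ‖deriv (γ ξ) t‖) < 2 * ‖u‖)
    -- `G` is the (unique) particular solution bounded at both `α₁` and `α₂`
    (G : ℂ → ℂ)
    (hGdiff : DifferentiableOn ℂ G Δ)
    (hGode : ∀ ζ ∈ Δ, deriv (deriv G) ζ - (u ^ 2 + ψ ζ) * G ζ = ϖ ζ)
    (hGbdd : ∀ ξ ∈ Ξ, ∃ C : ℝ, ∀ t ∈ Set.Ioo (0:ℝ) 1, ‖G (γ ξ t)‖ ≤ C) :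
    ∀ r, 1 ≤ r → ∀ ξ ∈ Ξ,
      ‖G ξ - (1 / u ^ 2) * ∑ s ∈ Finset.range n, Gc s ξ / u ^ (2 * s)‖ ≤
        ‖∑ s ∈ Finset.Icc n (n + r - 1), Gc s ξ / u ^ (2 * s + 2)‖
        + (1 / ‖u‖ ^ (2 * n + 2 * r + 2)) *
            (‖Gc (n + r) ξ‖
              + (1 / 2) * ∫ t in Set.Ioo (0:ℝ) 1,
                  ‖deriv (Gc (n + r)) (γ ξ t)‖ * ‖deriv (γ ξ) t‖)
        + ((⨆ t : Set.Ioo (0:ℝ) 1, ‖Gc (n + r) (γ ξ (t : ℝ))‖)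
              + (1 / 2) * ∫ t in Set.Ioo (0:ℝ) 1,
                  ‖deriv (Gc (n + r)) (γ ξ t)‖ * ‖deriv (γ ξ) t‖)
            / (2 * ‖u‖ ^ (2 * n + 2 * r + 3))
          * (1 - (1 / (2 * ‖u‖))
              * ∫ t in Set.Ioo (0:ℝ) 1, ‖ψ (γ ξ t)‖ * ‖deriv (γ ξ) t‖)⁻¹
          * ∫ t in Set.Ioo (0:ℝ) 1, ‖ψ (γ ξ t)‖ * ‖deriv (γ ξ) t‖ := by
  intro r hr ξ hξ
  have hGc := formal_series_coeff_differentiableOn hΔ hψ hϖ hG0 hGrec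
  obtain ⟨hEd, hEode⟩ := deriv_deriv_sub_partial_sum hΔ hu hGc hG0 hGrec hGdiff hGode (n + r)
  set E := fun z => G z - ∑ s ∈ Finset.range (n + r), Gc s z / u ^ (2 * s + 2) with hE
  have hu' : 0 < ‖u‖ := norm_pos_iff.2 hu
  have hT : ∀ m, ∀ t ∈ Set.Ioo (0:ℝ) 1,
      ‖Gc m (γ ξ t)‖ ≤ ⨆ t : Set.Ioo (0:ℝ) 1, ‖Gc m (γ ξ (t : ℝ))‖ :=
    fun m t ht => le_ciSup (hGsup ξ hξ m) (⟨t, ht⟩ : Set.Ioo (0:ℝ) 1)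
  have hEbdd : BddAbove (Set.range fun t : Set.Ioo (0:ℝ) 1 => ‖E (γ ξ (t : ℝ))‖) := by
    obtain ⟨C, hC⟩ := hGbdd ξ hξ
    refine ⟨C + ∑ s ∈ Finset.range (n + r),
      (⨆ t : Set.Ioo (0:ℝ) 1, ‖Gc s (γ ξ (t : ℝ))‖) / ‖u ^ (2 * s + 2)‖, ?_⟩
    rintro _ ⟨⟨t, ht⟩, rfl⟩
    refine (norm_sub_le _ _).trans (add_le_add (hC t ht) ((norm_sum_le _ _).trans ?_))
    refine Finset.sum_le_sum fun s _ => ?_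
    rw [norm_div]
    exact div_le_div_of_nonneg_right (hT s t ht) (norm_nonneg _)
  have hS : ∀ t ∈ Set.Ioo (0:ℝ) 1,
      ‖E (γ ξ t)‖ ≤ ⨆ t : Set.Ioo (0:ℝ) 1, ‖E (γ ξ (t : ℝ))‖ :=
    fun t ht => le_ciSup hEbdd (⟨t, ht⟩ : Set.Ioo (0:ℝ) 1)
  have key := fun t (ht : t ∈ Set.Ioo (0:ℝ) 1) =>
    norm_le_of_ode_along_path hΔ hu (n + r) hEd (hGc (n + r)) hEode (hγmem ξ hξ) (hγdiff ξ hξ)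
      (hmono ξ hξ) (hbot ξ hξ) (htop ξ hξ) (hψint ξ hξ) (hGint ξ hξ (n + r)) hS (hT (n + r)) ht
  have hsmall := hψsmall ξ hξ
  have hΨ0 : 0 ≤ ∫ t in Set.Ioo (0:ℝ) 1, ‖ψ (γ ξ t)‖ * ‖deriv (γ ξ) t‖ :=
    integral_nonneg fun t => by positivity
  obtain ⟨τ, hτ, hτξ⟩ := hγthrough ξ hξ
  have hkey := key τ hτ
  rw [hτξ] at hkey
  set S := ⨆ t : Set.Ioo (0:ℝ) 1, ‖E (γ ξ (t : ℝ))‖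
  set T := ⨆ t : Set.Ioo (0:ℝ) 1, ‖Gc (n + r) (γ ξ (t : ℝ))‖
  set D := ∫ t in Set.Ioo (0:ℝ) 1, ‖deriv (Gc (n + r)) (γ ξ t)‖ * ‖deriv (γ ξ) t‖
  set Ψ := ∫ t in Set.Ioo (0:ℝ) 1, ‖ψ (γ ξ t)‖ * ‖deriv (γ ξ) t‖
  have hpos : 0 < 1 - (1 / (2 * ‖u‖)) * Ψ := by
    rw [sub_pos, one_div, inv_mul_lt_iff₀ (by positivity)]
    linarith
  have hSle : S ≤ (1 / ‖u‖ ^ (2 * (n + r) + 2)) * (T + (1 / 2) * D)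
      + (1 / (2 * ‖u‖)) * (S * Ψ) := by
    have : Nonempty (Set.Ioo (0:ℝ) 1) := ⟨⟨τ, hτ⟩⟩
    refine ciSup_le fun t => (key t t.2).trans ?_
    gcongr
    exact hT (n + r) t t.2
  have hSle' : S ≤ (1 / ‖u‖ ^ (2 * (n + r) + 2)) * (T + (1 / 2) * D)
      * (1 - (1 / (2 * ‖u‖)) * Ψ)⁻¹ := by
    rw [← div_eq_mul_inv, le_div_iff₀ hpos]
    linarith
  have hsplit : G ξ - (1 / u ^ 2) * ∑ s ∈ Finset.range n, Gc s ξ / u ^ (2 * s)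
      = (∑ s ∈ Finset.Icc n (n + r - 1), Gc s ξ / u ^ (2 * s + 2)) + E ξ := by
    have h1 : Finset.Icc n (n + r - 1) = Finset.Ico n (n + r) := by
      ext s
      simp only [Finset.mem_Icc, Finset.mem_Ico]
      omega
    have h2 : (1 / u ^ 2) * ∑ s ∈ Finset.range n, Gc s ξ / u ^ (2 * s)
        = ∑ s ∈ Finset.range n, Gc s ξ / u ^ (2 * s + 2) := by
      rw [Finset.mul_sum]
      refine Finset.sum_congr rfl fun s _ => ?_
      field_simp
      ring
    rw [h1, h2, Finset.sum_Ico_eq_sub _ (Nat.le_add_right n r), hE]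
    ring
  rw [hsplit, add_assoc]
  refine (norm_add_le _ _).trans (add_le_add_right (hkey.trans ?_) _)
  have he : 2 * (n + r) + 2 = 2 * n + 2 * r + 2 := by ring
  rw [he] at hSle' ⊢
  refine add_le_add_right ?_ _
  refine (mul_le_mul_of_nonneg_left (mul_le_mul_of_nonneg_right hSle' hΨ0)
    (by positivity)).trans_eq ?_
  generalize (1 - (1 / (2 * ‖u‖)) * Ψ)⁻¹ = I
  field_simp
  ring
end

section
/- Let u ∈ ℂ \ {0}, let T and ε be differentiable complex-valued functions of ξ with |T(ξ)| < |u|², and suppose that for some κ ∈ [0,1) with (|u|² + |T(ξ)|)κ/(|u|² − |T(ξ)|) < 1 one has |ε(ξ)| ≤ κ|e^{uξ}| and |u⁻¹ ε′(ξ)| ≤ κ|e^{uξ}|. Define w(ξ) = e^{−uξ} (1 + T(ξ)/u²)⁻¹ { u⁻¹ε′(ξ) + (T(ξ)/u²) ε(ξ) }. Then |w(ξ)| < 1, and any value η(ξ) of log(1 + w(ξ)) with |η| minimal (in particular the principal value) satisfies |η(ξ)| ≤ −ln[ 1 − (|u|² + |T(ξ)|)κ / (|u|² − |T(ξ)|)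 ]. -/
/-- The principal logarithm is dominated on the unit disc by its majorant series. -/
lemma norm_clog_one_add_le_neg_log_one_sub_norm {z : ℂ} (hz : ‖z‖ < 1) :
    ‖Complex.log (1 + z)‖ ≤ -Real.log (1 - ‖z‖) := by
  have h₁ : HasSum (fun n : ℕ ↦ (-z) ^ (n + 1) / ((n + 1 : ℕ) : ℂ)) (-Complex.log (1 + z)) := by
    rw [hasSum_nat_add_iff (f := fun n : ℕ ↦ (-z) ^ n / (n : ℂ)) 1]
    simpa using Complex.hasSum_taylorSeries_neg_log (z := -z) (by simpa using hz)
  have h₂ := Real.hasSum_pow_div_log_of_abs_lt_one (x := ‖z‖) (by simpa using hz)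
  rw [← norm_neg, ← h₁.tsum_eq]
  refine tsum_of_norm_bounded h₂ fun n ↦ le_of_eq ?_
  rw [norm_div, norm_pow, norm_neg, Complex.norm_natCast, Nat.cast_add_one]

/-- A weighted combination of two quantities of size at most `κ * ‖c‖`, normalised by `c`
and by `1 + a` with `‖a‖ < 1`. -/
lemma norm_inv_mul_inv_one_add_mul_le {a c x y : ℂ} {κ : ℝ} (ha : ‖a‖ < 1) (hc : c ≠ 0)
    (hx : ‖x‖ ≤ κ * ‖c‖) (hy : ‖y‖ ≤ κ * ‖c‖) :
    ‖c⁻¹ * (1 + a)⁻¹ * (x + a * y)‖ ≤ (1 + ‖a‖) * κ / (1 - ‖a‖) := by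
  have hc' : 0 < ‖c‖ := norm_pos_iff.mpr hc
  have hden : 1 - ‖a‖ ≤ ‖1 + a‖ := by
    simpa using norm_sub_norm_le (1 : ℂ) (-a)
  have hnum : ‖x + a * y‖ ≤ (1 + ‖a‖) * κ * ‖c‖ :=
    calc ‖x + a * y‖ ≤ ‖x‖ + ‖a‖ * ‖y‖ := (norm_add_le _ _).trans_eq (by rw [norm_mul])
      _ ≤ κ * ‖c‖ + ‖a‖ * (κ * ‖c‖) := by gcongr
      _ = (1 + ‖a‖) * κ * ‖c‖ := by ring
  have hpos : 0 < 1 - ‖a‖ := sub_pos.mpr ha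
  calc ‖c⁻¹ * (1 + a)⁻¹ * (x + a * y)‖ = ‖c‖⁻¹ * ‖1 + a‖⁻¹ * ‖x + a * y‖ := by
        simp only [norm_mul, norm_inv]
    _ ≤ ‖c‖⁻¹ * (1 - ‖a‖)⁻¹ * ((1 + ‖a‖) * κ * ‖c‖) := by gcongr
    _ = (1 + ‖a‖) * κ / (1 - ‖a‖) := by field_simp

/-- The estimate (34)–(35): placing the error of the derivative of a Liouville–Green
solution in the exponent.  With
`w(ξ) = e^{-uξ}(1 + T(ξ)/u²)⁻¹{u⁻¹ε'(ξ) + (T(ξ)/u²)ε(ξ)}`, if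
`|ε(ξ)| ≤ κ|e^{uξ}|`, `|u⁻¹ε'(ξ)| ≤ κ|e^{uξ}|`, `|T(ξ)| < |u|²` and
`(|u|² + |T(ξ)|)κ/(|u|² - |T(ξ)|) < 1`, then `|w(ξ)| < 1` and any value `η` of
`log(1 + w(ξ))` of minimal modulus (in particular the principal value) satisfies
`|η| ≤ -ln[1 - (|u|² + |T(ξ)|)κ/(|u|² - |T(ξ)|)]`. -/
theorem log_error_in_exponent_bound
    (u : ℂ) (hu : u ≠ 0)
    (T ε : ℂ → ℂ) (ξ : ℂ)
    (hT : DifferentiableAt ℂ T ξ) (hε : DifferentiableAt ℂ ε ξ)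
    (hTlt : ‖T ξ‖ < ‖u‖ ^ 2)
    (κ : ℝ) (hκ0 : 0 ≤ κ) (hκ1 : κ < 1)
    (hρ : (‖u‖ ^ 2 + ‖T ξ‖) * κ / (‖u‖ ^ 2 - ‖T ξ‖) < 1)
    (hεb : ‖ε ξ‖ ≤ κ * ‖Complex.exp (u * ξ)‖)
    (hε'b : ‖deriv ε ξ / u‖ ≤ κ * ‖Complex.exp (u * ξ)‖)
    (w : ℂ)
    (hw : w = Complex.exp (-(u * ξ)) * (1 + T ξ / u ^ 2)⁻¹
      * (deriv ε ξ / u + (T ξ / u ^ 2) * ε ξ)) :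
    ‖w‖ < 1 ∧
    ‖Complex.log (1 + w)‖ ≤
      -Real.log (1 - (‖u‖ ^ 2 + ‖T ξ‖) * κ / (‖u‖ ^ 2 - ‖T ξ‖)) ∧
    (∀ η : ℂ, Complex.exp η = 1 + w → ‖η‖ ≤ ‖Complex.log (1 + w)‖ →
      ‖η‖ ≤ -Real.log (1 - (‖u‖ ^ 2 + ‖T ξ‖) * κ / (‖u‖ ^ 2 - ‖T ξ‖))) := by
  have hu2 : 0 < ‖u‖ ^ 2 := by positivity
  have hnorm : ‖T ξ / u ^ 2‖ = ‖T ξ‖ / ‖u‖ ^ 2 := by rw [norm_div, norm_pow]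
  have hlt : ‖T ξ / u ^ 2‖ < 1 := by rwa [hnorm, div_lt_one hu2]
  have hwρ : ‖w‖ ≤ (‖u‖ ^ 2 + ‖T ξ‖) * κ / (‖u‖ ^ 2 - ‖T ξ‖) := by
    rw [hw, Complex.exp_neg]
    refine (norm_inv_mul_inv_one_add_mul_le hlt (Complex.exp_ne_zero _) hε'b hεb).trans_eq ?_
    have h₁ : 1 + ‖T ξ / u ^ 2‖ = (‖u‖ ^ 2 + ‖T ξ‖) / ‖u‖ ^ 2 := by
      rw [hnorm, add_div, div_self hu2.ne']
    have h₂ : 1 - ‖T ξ / u ^ 2‖ = (‖u‖ ^ 2 - ‖T ξ‖) / ‖u‖ ^ 2 := by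
      rw [hnorm, sub_div, div_self hu2.ne']
    rw [h₁, h₂, div_mul_eq_mul_div, div_div_div_cancel_right₀ hu2.ne']
  have hw1 : ‖w‖ < 1 := hwρ.trans_lt hρ
  have hlog : ‖Complex.log (1 + w)‖ ≤
      -Real.log (1 - (‖u‖ ^ 2 + ‖T ξ‖) * κ / (‖u‖ ^ 2 - ‖T ξ‖)) :=
    (norm_clog_one_add_le_neg_log_one_sub_norm hw1).trans <|
      neg_le_neg <| Real.log_le_log (sub_pos.mpr hρ) (sub_le_sub_left hwρ 1)
  exact ⟨hw1, hlog, fun η _ hη ↦ hη.trans hlog⟩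
end

section
/- Define polynomials F̃₁(p) = ⅛ p²(1 − p²)(5p² − 1), F̃₂(p) = ⅛ p³(1 − p²)(12p² − 15p⁴ − 1), and F̃_{s+1}(p) = ½ p²(1 − p²) dF̃_s(p)/dp − ½ Σ_{j=1}^{s−1} F̃_j(p) F̃_{s−j}(p) for s ≥ 2. Then for every s ≥ 1 the polynomial F̃_s(p) is divisible by p²(1 − p²); that is, there exists a polynomial H_s with F̃_s(p) = p²(1 − p²) H_s(p). Consequently each function Ẽ_s(p) = −∫₀^p F̃_s(q)/(q²(1 − q²)) dq = −∫₀^p H_s(q) dq is a polynomial in p vanishing at p = 0. -/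
open Polynomial in
theorem Polynomial.exists_derivative_eq_and_eval_zero (H : ℝ[X]) :
    ∃ Q : ℝ[X], derivative Q = H ∧ Q.eval 0 = 0 := by
  induction H using Polynomial.induction_on' with
  | add f g hf hg =>
    obtain ⟨A, hA, hA0⟩ := hf
    obtain ⟨B, hB, hB0⟩ := hg
    exact ⟨A + B, by simp [hA, hB], by simp [hA0, hB0]⟩
  | monomial n a =>
    refine ⟨monomial (n + 1) (a / (n + 1)), ?_, by simp [eval_monomial]⟩
    have h : (n : ℝ) + 1 ≠ 0 := by positivity
    rw [derivative_monomial]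
    push_cast
    rw [div_mul_cancel₀ _ h]

open Polynomial in
theorem Polynomial.integral_eval_derivative (Q : ℝ[X]) (a b : ℝ) :
    ∫ q in a..b, (derivative Q).eval q = Q.eval b - Q.eval a :=
  intervalIntegral.integral_eq_sub_of_hasDerivAt (fun x _ => Q.hasDerivAt x)
    ((derivative Q).continuous.intervalIntegrable a b)

open Polynomial in
/-- Any sequence of functions obeying the quadratic recursion whose first two terms are polynomial
multiples of a polynomial `w` consists of polynomial multiples of `w`. -/
theorem exists_polynomial_mul_of_quadratic_recursion (w : ℝ[X]) (F : ℕ → ℝ → ℝ)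
    (h1 : ∃ H : ℝ[X], ∀ p, F 1 p = w.eval p * H.eval p)
    (h2 : ∃ H : ℝ[X], ∀ p, F 2 p = w.eval p * H.eval p)
    (hrec : ∀ s, 2 ≤ s → ∀ p,
      F (s + 1) p = w.eval p * deriv (F s) p / 2
        - (∑ j ∈ Finset.Icc 1 (s - 1), F j p * F (s - j) p) / 2)
    (s : ℕ) (hs : 1 ≤ s) : ∃ H : ℝ[X], ∀ p, F s p = w.eval p * H.eval p := by
  induction s using Nat.strong_induction_on with
  | _ s ih =>
    obtain rfl | rfl | ⟨t, ht, rfl⟩ : s = 1 ∨ s = 2 ∨ ∃ t, 2 ≤ t ∧ s = t + 1 := by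
      obtain h | h | h : s = 1 ∨ s = 2 ∨ 3 ≤ s := by omega
      · exact .inl h
      · exact .inr (.inl h)
      · exact .inr (.inr ⟨s - 1, by omega, by omega⟩)
    · exact h1
    · exact h2
    · choose! G hG using ih
      have hderiv (p : ℝ) : deriv (F t) p = (derivative (w * G t)).eval p := by
        rw [← Polynomial.deriv]
        congr 1
        ext x
        rw [hG t (by omega) (by omega), eval_mul]
      refine ⟨C (1 / 2) * derivative (w * G t)
        - C (1 / 2) * ∑ j ∈ Finset.Icc 1 (t - 1), w * G j * G (t - j), fun p => ?_⟩
      have hsum : ∑ j ∈ Finset.Icc 1 (t - 1), F j p * F (t - j) p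
          = w.eval p * (∑ j ∈ Finset.Icc 1 (t - 1), w * G j * G (t - j)).eval p := by
        rw [eval_finsetSum, Finset.mul_sum]
        refine Finset.sum_congr rfl fun j hj => ?_
        rw [Finset.mem_Icc] at hj
        rw [hG j (by omega) hj.1, hG (t - j) (by omega) (by omega)]
        simp only [eval_mul]
        ring
      rw [hrec t ht, hderiv, hsum, eval_sub, eval_mul (p := C _), eval_mul (p := C _), eval_C]
      ring


/-- Divisibility of the modified Bessel coefficients `F̃_s(p)` by `p²(1-p²)`, and the
consequence that each `Ẽ_s(p) = -∫₀^p F̃_s(q)/(q²(1-q²)) dq` is a polynomial in `p`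
vanishing at `p = 0`. -/
theorem bessel_Ftilde_divisible_and_Etilde_polynomial
    (F : ℕ → ℝ → ℝ)
    (hF1 : ∀ p, F 1 p = p ^ 2 * (1 - p ^ 2) * (5 * p ^ 2 - 1) / 8)
    (hF2 : ∀ p, F 2 p = p ^ 3 * (1 - p ^ 2) * (12 * p ^ 2 - 15 * p ^ 4 - 1) / 8)
    (hFrec : ∀ s, 2 ≤ s → ∀ p,
      F (s + 1) p = p ^ 2 * (1 - p ^ 2) * deriv (F s) p / 2
        - (∑ j ∈ Finset.Icc 1 (s - 1), F j p * F (s - j) p) / 2) :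
    ∀ s, 1 ≤ s →
      ∃ H P : Polynomial ℝ,
        (∀ p : ℝ, F s p = p ^ 2 * (1 - p ^ 2) * H.eval p) ∧
        (∀ p : ℝ, (-∫ q in (0:ℝ)..p, F s q / (q ^ 2 * (1 - q ^ 2)))
          = -∫ q in (0:ℝ)..p, H.eval q) ∧
        P.eval 0 = 0 ∧
        (∀ p : ℝ, (-∫ q in (0:ℝ)..p, F s q / (q ^ 2 * (1 - q ^ 2))) = P.eval p) := by
  intro s hs
  obtain ⟨H, hH⟩ : ∃ H : Polynomial ℝ, ∀ p, F s p = p ^ 2 * (1 - p ^ 2) * H.eval p := by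
    have key := exists_polynomial_mul_of_quadratic_recursion
      (Polynomial.X ^ 2 * (1 - Polynomial.X ^ 2)) F
      ⟨Polynomial.C (1 / 8) * (5 * Polynomial.X ^ 2 - 1), fun p => by
        rw [hF1]; simp; ring⟩
      ⟨Polynomial.C (1 / 8) * (Polynomial.X * (12 * Polynomial.X ^ 2 - 15 * Polynomial.X ^ 4 - 1)),
        fun p => by rw [hF2]; simp; ring⟩
      (fun s hs p => by rw [hFrec s hs]; simp) s hs
    simpa using key
  obtain ⟨Q, hQ, hQ0⟩ := H.exists_derivative_eq_and_eval_zero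
  have hint (p : ℝ) : ∫ q in (0:ℝ)..p, F s q / (q ^ 2 * (1 - q ^ 2))
      = ∫ q in (0:ℝ)..p, H.eval q := by
    have hfin : ({0, 1, -1} : Set ℝ).Finite := by simp
    refine intervalIntegral.integral_congr_ae ?_
    filter_upwards [hfin.countable.ae_notMem MeasureTheory.volume] with q hq _
    simp only [Set.mem_insert_iff, Set.mem_singleton_iff, not_or] at hq
    have hw : q ^ 2 * (1 - q ^ 2) ≠ 0 := by
      have hne : q ^ 2 ≠ 1 := fun h => (by simpa using h : q = 1 ∨ q = -1).elim hq.2.1 hq.2.2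
      exact mul_ne_zero (pow_ne_zero 2 hq.1) (sub_ne_zero.mpr hne.symm)
    rw [hH, mul_div_cancel_left₀ _ hw]
  refine ⟨H, -Q, hH, fun p => by rw [hint], by simp [hQ0], fun p => ?_⟩
  rw [hint, ← hQ, Q.integral_eval_derivative, hQ0, sub_zero, Polynomial.eval_neg]
end
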